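/- arXiv:math-ph/0702090 — 5 statements merged into one kernel-verified Lean document; each statement's English description precedes it below -/
import Mathlib

section
/- Let (Q_i)_{i≥1} be a positive sequence and z_s > 0 such that the sequence {Q_i z_s^i}_{i≥1} is nonincreasing, and let 0 < c_1 < z_s. Then for all j ≥ 1, ∑_{i=j+1}^{∞} i Q_i c_1^i ≤ C j Q_{j+1} c_1^{j+1}, where C = 3 z_s^2 / (z_s − c_1)^2. -/
open Filter Topology

/-- If `Q i * z ^ i` is nonincreasing from `m` on, then `Q i * c ^ i` decays geometrically
with ratio `c / z`. -/
lemma mul_pow_add_le_geometric {Q : ℕ → ℝ} {z c : ℝ} {m : ℕ} (hz : 0 < z) (hc : 0 ≤ c)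
    (h : ∀ i, m ≤ i → Q (i + 1) * z ^ (i + 1) ≤ Q i * z ^ i) (k : ℕ) :
    Q (m + k) * c ^ (m + k) ≤ Q m * c ^ m * (c / z) ^ k := by
  have hanti : Antitone fun n ↦ Q (m + n) * z ^ (m + n) :=
    antitone_nat_of_succ_le fun n ↦ h (m + n) (Nat.le_add_right m n)
  have hpow (n : ℕ) : z ^ n * (c / z) ^ n = c ^ n := by
    rw [← mul_pow, mul_div_cancel₀ c hz.ne']
  calc Q (m + k) * c ^ (m + k)
      = Q (m + k) * z ^ (m + k) * (c / z) ^ (m + k) := by rw [mul_assoc, hpow]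
    _ ≤ Q m * z ^ m * (c / z) ^ (m + k) :=
        mul_le_mul_of_nonneg_right (hanti (Nat.zero_le k)) (by positivity)
    _ = Q m * c ^ m * (c / z) ^ k := by rw [← hpow m, pow_add]; ring

/-- The arithmetico-geometric series `∑ (m + k) r ^ k`. -/
lemma hasSum_add_mul_geometric {r : ℝ} (hr0 : 0 ≤ r) (hr1 : r < 1) (m : ℕ) :
    HasSum (fun k : ℕ ↦ ((m + k : ℕ) : ℝ) * r ^ k) (m * (1 - r)⁻¹ + r / (1 - r) ^ 2) := by
  have hr : ‖r‖ < 1 := by rwa [Real.norm_of_nonneg hr0]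
  simpa only [Nat.cast_add, add_mul] using
    ((hasSum_geometric_of_lt_one hr0 hr1).mul_left (m : ℝ)).add
      (hasSum_coe_mul_geometric_of_norm_lt_one hr)

/-- For a positive sequence `Q` with `Q i * zs ^ i` nonincreasing and `0 < c1 < zs`,
the tail sum `∑_{i = j+1}^∞ i Q_i c1^i` is bounded by `3 zs² / (zs − c1)² · j Q_{j+1} c1^{j+1}`. -/
theorem tail_sum_bound (Q : ℕ → ℝ) (zs c1 : ℝ)
    (hQpos : ∀ i : ℕ, 1 ≤ i → 0 < Q i)
    (hzs : 0 < zs)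
    (hreg : ∀ i : ℕ, 1 ≤ i → Q (i + 1) * zs ^ (i + 1) ≤ Q i * zs ^ i)
    (hc1pos : 0 < c1) (hc1lt : c1 < zs)
    (j : ℕ) (hj : 1 ≤ j) :
    ∑' k : ℕ, ((j + 1 + k : ℕ) : ℝ) * Q (j + 1 + k) * c1 ^ (j + 1 + k)
      ≤ 3 * zs ^ 2 / (zs - c1) ^ 2 * j * Q (j + 1) * c1 ^ (j + 1) := by
  set r := c1 / zs with hr
  have hr0 : 0 ≤ r := by positivity
  have hr1 : r < 1 := (div_lt_one hzs).2 hc1lt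
  set A := Q (j + 1) * c1 ^ (j + 1) with hA
  have hA0 : 0 ≤ A := mul_nonneg (hQpos _ (by lia)).le (by positivity)
  have hterm (k : ℕ) : ((j + 1 + k : ℕ) : ℝ) * Q (j + 1 + k) * c1 ^ (j + 1 + k)
      ≤ A * (((j + 1 + k : ℕ) : ℝ) * r ^ k) := by
    have hdecay := mul_pow_add_le_geometric (m := j + 1) hzs hc1pos.le
      (fun i hi ↦ hreg i (by lia)) k
    calc ((j + 1 + k : ℕ) : ℝ) * Q (j + 1 + k) * c1 ^ (j + 1 + k)
        = ((j + 1 + k : ℕ) : ℝ) * (Q (j + 1 + k) * c1 ^ (j + 1 + k)) := mul_assoc _ _ _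
      _ ≤ ((j + 1 + k : ℕ) : ℝ) * (A * r ^ k) :=
          mul_le_mul_of_nonneg_left hdecay (Nat.cast_nonneg _)
      _ = A * (((j + 1 + k : ℕ) : ℝ) * r ^ k) := mul_left_comm _ _ _
  have hnonneg (k : ℕ) : 0 ≤ ((j + 1 + k : ℕ) : ℝ) * Q (j + 1 + k) * c1 ^ (j + 1 + k) :=
    mul_nonneg (mul_nonneg (Nat.cast_nonneg _) (hQpos _ (by lia)).le) (by positivity)
  have hsum := (hasSum_add_mul_geometric hr0 hr1 (j + 1)).mul_left A
  have hs : 0 < 1 - r := sub_pos.2 hr1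
  have hj' : (1 : ℝ) ≤ j := by exact_mod_cast hj
  have hbound : ((j + 1 : ℕ) : ℝ) * (1 - r)⁻¹ + r / (1 - r) ^ 2 ≤ 3 * j / (1 - r) ^ 2 := by
    have heq : ((j + 1 : ℕ) : ℝ) * (1 - r)⁻¹ + r / (1 - r) ^ 2
        = ((j + 1) * (1 - r) + r) / (1 - r) ^ 2 := by
      push_cast
      field_simp
    rw [heq]
    gcongr
    nlinarith
  have hconst : zs ^ 2 / (zs - c1) ^ 2 = 1 / (1 - r) ^ 2 := by
    rw [hr, one_sub_div hzs.ne', div_pow, one_div_div]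
  calc ∑' k : ℕ, ((j + 1 + k : ℕ) : ℝ) * Q (j + 1 + k) * c1 ^ (j + 1 + k)
      ≤ A * (((j + 1 : ℕ) : ℝ) * (1 - r)⁻¹ + r / (1 - r) ^ 2) :=
        hasSum_le hterm (Summable.of_nonneg_of_le hnonneg hterm hsum.summable).hasSum hsum
    _ ≤ A * (3 * j / (1 - r) ^ 2) := mul_le_mul_of_nonneg_left hbound hA0
    _ = 3 * zs ^ 2 / (zs - c1) ^ 2 * j * Q (j + 1) * c1 ^ (j + 1) := by
        rw [mul_div_assoc 3 (zs ^ 2), hconst, hA]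
        ring
end

section
/- For all real λ and k with 0 ≤ λ ≤ 1 and 1 ≤ k ≤ 2 − λ, and all real x, y ≥ 0, the inequality (x^λ + y^λ) · ((x+y)^k − x^k − y^k) ≤ C_{k,λ} (x y)^{(λ + k)/2} holds with the constant C_{k,λ} = (1 + 2^λ) 2^{k−1} k. -/
/-- Tangent-line bound: `b^k - a^k ≤ k b^{k-1} (b - a)` for `k ≥ 1`. -/
theorem rpow_sub_rpow_le_mul_sub {a b k : ℝ} (ha : 0 ≤ a) (hb : 0 < b) (hk : 1 ≤ k) :
    b ^ k - a ^ k ≤ k * b ^ (k - 1) * (b - a) := by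
  have hab : 0 ≤ a / b := by positivity
  have h := one_add_mul_self_le_rpow_one_add (s := a / b - 1) (by linarith) hk
  rw [add_sub_cancel, Real.div_rpow ha hb.le, le_div_iff₀ (by positivity)] at h
  have hbk : b ^ k = b ^ (k - 1) * b := by
    rw [← Real.rpow_add_one hb.ne', sub_add_cancel]
  have e : (1 + k * (a / b - 1)) * b ^ k = b ^ k - k * b ^ (k - 1) * (b - a) := by
    rw [hbk]
    field_simp
    ring
  linarith

theorem power_inequality_of_le {lam k x y : ℝ}
    (hlam0 : 0 ≤ lam) (hk1 : 1 ≤ k) (hk2 : k ≤ 2 - lam) (hx : 0 < x) (hxy : x ≤ y) :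
    (x ^ lam + y ^ lam) * ((x + y) ^ k - x ^ k - y ^ k)
      ≤ (1 + (2 : ℝ) ^ lam) * (2 : ℝ) ^ (k - 1) * k * (x * y) ^ ((lam + k) / 2) := by
  have hy : 0 < y := hx.trans_le hxy
  have hsum : x ^ lam + y ^ lam ≤ (1 + (2 : ℝ) ^ lam) * y ^ lam := by
    have h1 : x ^ lam ≤ y ^ lam := by gcongr
    have h2 : (1 : ℝ) ≤ 2 ^ lam := Real.one_le_rpow one_le_two hlam0
    have h3 : 0 ≤ y ^ lam := by positivity
    nlinarith
  have hdiff : (x + y) ^ k - x ^ k - y ^ k ≤ k * (2 ^ (k - 1) * y ^ (k - 1)) * x := by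
    have h1 := rpow_sub_rpow_le_mul_sub hy.le (add_pos hx hy) hk1
    rw [add_sub_cancel_right] at h1
    have h2 : (x + y) ^ (k - 1) ≤ 2 ^ (k - 1) * y ^ (k - 1) := by
      rw [← Real.mul_rpow zero_le_two hy.le]
      exact Real.rpow_le_rpow (by positivity) (by linarith) (by linarith)
    have h3 : k * (x + y) ^ (k - 1) * x ≤ k * (2 ^ (k - 1) * y ^ (k - 1)) * x := by gcongr
    have h4 : 0 ≤ x ^ k := by positivity
    linarith
  have hmono : y ^ lam * y ^ (k - 1) * x ≤ (x * y) ^ ((lam + k) / 2) := by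
    have h1 : x ^ (1 - (lam + k) / 2) ≤ y ^ (1 - (lam + k) / 2) :=
      Real.rpow_le_rpow hx.le hxy (by linarith)
    calc y ^ lam * y ^ (k - 1) * x
        = x ^ ((lam + k) / 2) * x ^ (1 - (lam + k) / 2) * y ^ (lam + k - 1) := by
          rw [← Real.rpow_add hx, ← Real.rpow_add hy, add_sub_cancel, Real.rpow_one,
            ← add_sub_assoc, mul_comm]
      _ ≤ x ^ ((lam + k) / 2) * y ^ (1 - (lam + k) / 2) * y ^ (lam + k - 1) := by gcongr
      _ = (x * y) ^ ((lam + k) / 2) := by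
          rw [mul_assoc, ← Real.rpow_add hy, Real.mul_rpow hx.le hy.le]
          ring_nf
  calc (x ^ lam + y ^ lam) * ((x + y) ^ k - x ^ k - y ^ k)
      ≤ (x ^ lam + y ^ lam) * (k * (2 ^ (k - 1) * y ^ (k - 1)) * x) := by gcongr
    _ ≤ ((1 + (2 : ℝ) ^ lam) * y ^ lam) * (k * (2 ^ (k - 1) * y ^ (k - 1)) * x) := by gcongr
    _ = (1 + (2 : ℝ) ^ lam) * 2 ^ (k - 1) * k * (y ^ lam * y ^ (k - 1) * x) := by ring
    _ ≤ _ := by gcongr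

/-- For `0 ≤ λ ≤ 1`, `1 ≤ k ≤ 2 − λ` and `x, y ≥ 0`,
`(x^λ + y^λ)((x+y)^k − x^k − y^k) ≤ (1 + 2^λ) 2^{k−1} k (xy)^{(λ+k)/2}`
(real powers, with `0^0 = 1`). -/
theorem power_inequality (lam k x y : ℝ)
    (hlam0 : 0 ≤ lam) (hlam1 : lam ≤ 1)
    (hk1 : 1 ≤ k) (hk2 : k ≤ 2 - lam)
    (hx : 0 ≤ x) (hy : 0 ≤ y) :
    (x ^ lam + y ^ lam) * ((x + y) ^ k - x ^ k - y ^ k)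
      ≤ (1 + (2 : ℝ) ^ lam) * (2 : ℝ) ^ (k - 1) * k * (x * y) ^ ((lam + k) / 2) := by
  have hk : k ≠ 0 := by linarith
  have hs : (lam + k) / 2 ≠ 0 := by linarith
  rcases hx.eq_or_lt with rfl | hx
  · simp [Real.zero_rpow hk, Real.zero_rpow hs]
  rcases hy.eq_or_lt with rfl | hy
  · simp [Real.zero_rpow hk, Real.zero_rpow hs]
  rcases le_total x y with h | h
  · exact power_inequality_of_le hlam0 hk1 hk2 hx h
  · have := power_inequality_of_le hlam0 hk1 hk2 hy h
    rwa [add_comm (y ^ lam), add_comm y, sub_right_comm, mul_comm y] at this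
end

section
/- For all real x > 0, x (log x)^2 ≤ 4 (x log x − x + 1) · max{1, log x}. -/
theorem sq_le_four_mul_exp_neg_add_sub_one {t : ℝ} (ht : t ≤ 2) :
    t ^ 2 ≤ 4 * (t - 1 + Real.exp (-t)) := by
  have h : 1 - t / 2 ≤ Real.exp (-t / 2) := by linarith [Real.add_one_le_exp (-t / 2)]
  have hsq : Real.exp (-t) = Real.exp (-t / 2) ^ 2 := by
    rw [← Real.exp_nat_mul]
    congr 1
    push_cast
    ring
  have := pow_le_pow_left₀ (by linarith) h 2
  rw [hsq]
  linarith

theorem sq_le_four_mul_exp_neg_add_sub_one_mul_max (t : ℝ) :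
    t ^ 2 ≤ 4 * (t - 1 + Real.exp (-t)) * max 1 t := by
  rcases le_total t 1 with h | h
  · rw [max_eq_left h, mul_one]
    exact sq_le_four_mul_exp_neg_add_sub_one (by linarith)
  · rw [max_eq_right h, sq]
    refine mul_le_mul_of_nonneg_right ?_ (by linarith)
    rcases le_total t 2 with h' | h'
    · nlinarith [sq_le_four_mul_exp_neg_add_sub_one h']
    · linarith [Real.exp_pos (-t)]

/-- For `x > 0`, `x (log x)² ≤ 4 (x log x − x + 1) max{1, log x}`. -/
theorem xlogx_sq_bound (x : ℝ) (hx : 0 < x) :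
    x * (Real.log x) ^ 2 ≤ 4 * (x * Real.log x - x + 1) * max 1 (Real.log x) := by
  have h := mul_le_mul_of_nonneg_left
    (sq_le_four_mul_exp_neg_add_sub_one_mul_max (Real.log x)) hx.le
  rw [Real.exp_neg, Real.exp_log hx] at h
  refine h.trans_eq ?_
  field_simp
end

section
/- Let m, k be real numbers with m ≥ 1 and k < m. For any nonnegative sequence (c_i)_{i≥1} with M := ∑_{i≥1} i^m c_i < ∞, there exists a constant C, depending only on k, m and M, such that ∑_{i≥1} i^k c_i |log c_i| ≤ C (with the convention that a term with c_i = 0 contributes 0). -/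
open Real in
/-- Either `c` is large, or `c ≥ x ^ (-q)`, or `c` is so small that a power of `x` controls it. -/
theorem rpow_mul_abs_log_le {m k q M x c : ℝ} (hk : k < m) (hq : 0 ≤ q) (hx : 1 ≤ x)
    (hc : 0 ≤ c) (hcM : c ≤ M) :
    x ^ k * c * |log c| ≤ (M + q / (m - k)) * (x ^ m * c) + 2 * x ^ (k - q / 2) := by
  have hx0 : 0 < x := by linarith
  have hmk : 0 < m - k := by linarith
  have hM : 0 ≤ M := hc.trans hcM
  have hkm : x ^ k ≤ x ^ m := rpow_le_rpow_of_exponent_le hx hk.le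
  have hxk : 0 ≤ x ^ k := by positivity
  have hxm : 0 ≤ x ^ m * c := by positivity
  have hr : 0 ≤ x ^ (k - q / 2) := by positivity
  have hd : 0 ≤ q / (m - k) := by positivity
  rcases hc.eq_or_lt with rfl | hc0
  · simpa using hr
  rcases le_total 1 c with h1 | h1
  · have hlog : |log c| ≤ M := by
      rw [abs_of_nonneg (log_nonneg h1)]
      exact (log_le_self hc).trans hcM
    have : x ^ k * c * |log c| ≤ x ^ m * c * M := by gcongr
    nlinarith [mul_nonneg hd hxm]
  have habs : |log c| = -log c := abs_of_nonpos (log_nonpos hc h1)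
  rcases le_total (x ^ (-q)) c with h2 | h2
  · have hlog : |log c| ≤ q * (x ^ (m - k) / (m - k)) := by
      have h3 := log_le_log (by positivity) h2
      rw [log_rpow hx0] at h3
      have h4 := mul_le_mul_of_nonneg_left (log_le_rpow_div hx0.le hmk) hq
      linarith
    have h5 : x ^ k * x ^ (m - k) = x ^ m := by
      rw [← rpow_add hx0]
      ring_nf
    have : x ^ k * c * |log c| ≤ q / (m - k) * (x ^ m * c) := by
      calc x ^ k * c * |log c| ≤ x ^ k * c * (q * (x ^ (m - k) / (m - k))) := by gcongr
        _ = q / (m - k) * (x ^ k * x ^ (m - k) * c) := by ring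
        _ = _ := by rw [h5]
    nlinarith [mul_nonneg hM hxm]
  · have h3 : |log c| * c ^ (1 / 2 : ℝ) ≤ 2 := by
      have := (abs_log_mul_self_rpow_lt c (1 / 2) hc0 h1 (by norm_num)).le
      rw [abs_mul, abs_of_nonneg (rpow_nonneg hc _)] at this
      norm_num at this ⊢
      exact this
    have h4 : c ^ (1 / 2 : ℝ) ≤ x ^ (-(q / 2)) := by
      refine (rpow_le_rpow hc h2 (by norm_num)).trans_eq ?_
      rw [← rpow_mul hx0.le]
      ring_nf
    have h5 : c ^ (1 / 2 : ℝ) * c ^ (1 / 2 : ℝ) = c := by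
      rw [← rpow_add hc0]
      norm_num
    have h6 : x ^ k * x ^ (-(q / 2)) = x ^ (k - q / 2) := by
      rw [← rpow_add hx0, sub_eq_add_neg]
    have : x ^ k * c * |log c| ≤ 2 * x ^ (k - q / 2) := by
      calc x ^ k * c * |log c|
          = x ^ k * c ^ (1 / 2 : ℝ) * (|log c| * c ^ (1 / 2 : ℝ)) := by
            nth_rewrite 1 [← h5]
            ring
        _ ≤ x ^ k * x ^ (-(q / 2)) * 2 := by gcongr
        _ = _ := by rw [h6, mul_comm]
    nlinarith [mul_nonneg (add_nonneg hM hd) hxm]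


/-- If `m ≥ 1`, `k < m` and a nonnegative sequence has `∑ i^m c_i = M < ∞`, then
`∑ i^k c_i |log c_i|` is finite and bounded by a constant depending only on `k`, `m`, `M`.
(`Real.log 0 = 0`, so terms with `c_i = 0` contribute `0`.) -/
theorem moment_log_bound (m k : ℝ) (hm : 1 ≤ m) (hk : k < m) (M : ℝ) :
    ∃ C : ℝ, ∀ c : ℕ → ℝ, (∀ i, 0 ≤ c i) →
      HasSum (fun i : ℕ => ((i : ℝ) + 1) ^ m * c (i + 1)) M →
      Summable (fun i : ℕ => ((i : ℝ) + 1) ^ k * c (i + 1) * |Real.log (c (i + 1))|) ∧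
      ∑' i : ℕ, ((i : ℝ) + 1) ^ k * c (i + 1) * |Real.log (c (i + 1))| ≤ C := by
  have hs : Summable (fun i : ℕ => 2 * ((i : ℝ) + 1) ^ (-2 : ℝ)) := by
    have h := (summable_nat_add_iff 1).mpr (Real.summable_nat_rpow.mpr (by norm_num : (-2 : ℝ) < -1))
    simpa using h.mul_left 2
  set A : ℝ := M + 2 * (m + 2) / (m - k) with hA
  refine ⟨A * M + ∑' i : ℕ, 2 * ((i : ℝ) + 1) ^ (-2 : ℝ), fun c hc hM => ?_⟩
  have hle : ∀ i : ℕ, ((i : ℝ) + 1) ^ k * c (i + 1) * |Real.log (c (i + 1))| ≤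
      A * (((i : ℝ) + 1) ^ m * c (i + 1)) + 2 * ((i : ℝ) + 1) ^ (-2 : ℝ) := by
    intro i
    have hx : (1 : ℝ) ≤ (i : ℝ) + 1 := by linarith [Nat.cast_nonneg (α := ℝ) i]
    have hcM : c (i + 1) ≤ M := by
      have h1 := le_hasSum hM i fun j _ => mul_nonneg (by positivity) (hc (j + 1))
      have h2 := Real.one_le_rpow hx (by linarith : 0 ≤ m)
      exact (le_mul_of_one_le_left (hc _) h2).trans h1
    have h := rpow_mul_abs_log_le (q := 2 * (m + 2)) hk (by linarith) hx (hc (i + 1)) hcM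
    have hp : ((i : ℝ) + 1) ^ (k - 2 * (m + 2) / 2) ≤ ((i : ℝ) + 1) ^ (-2 : ℝ) :=
      Real.rpow_le_rpow_of_exponent_le hx (by linarith)
    linarith
  have hbound := (hM.mul_left A).add hs.hasSum
  have hsum := Summable.of_nonneg_of_le
    (fun i => mul_nonneg (mul_nonneg (by positivity) (hc (i + 1))) (abs_nonneg _))
    hle hbound.summable
  exact ⟨hsum, hasSum_le hle hsum.hasSum hbound⟩
end

section
/- Assume hypothesis (growth) with constants K > 0 and 0 ≤ λ < 1, in particular a_{i,j} ≤ K (i^λ + j^λ) for all i,j ≥ 1. Then there exists a constant C', depending only on λ (one may take C' = (1 + 2^λ) 2^{1−λ} (2−λ)), such that for every nonnegative sequence (c_i)_{i≥1} with ∑_{i≥1} i c_i = ρ < ∞, (1/2) ∑_{i,j≥1} a_{i,j} c_i c_j ( (i+j)^{2−λ} − i^{2−λ} − j^{2−λ} ) ≤ K C' ρ^2. -/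
open scoped ENNReal

/-- Tangent-line bound for the convex function `t ↦ t ^ p`, taken at the right end point. -/
theorem add_rpow_sub_rpow_le {x y p : ℝ} (hx : 0 < x) (hy : 0 < y) (hp : 1 ≤ p) :
    (x + y) ^ p - y ^ p ≤ p * x * (x + y) ^ (p - 1) := by
  have hxy : 0 < x + y := by positivity
  have hle : x / (x + y) ≤ 1 := by rw [div_le_one hxy]; linarith
  have hB := one_add_mul_self_le_rpow_one_add (s := -(x / (x + y))) (by linarith) hp
  have hs : 1 + -(x / (x + y)) = y / (x + y) := by field_simp; ring
  rw [hs, Real.div_rpow hy.le hxy.le, le_div_iff₀ (by positivity)] at hB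
  have hpow : (x + y) ^ p = (x + y) ^ (p - 1) * (x + y) := by
    rw [← Real.rpow_add_one hxy.ne']; ring_nf
  have hmul : (1 + p * -(x / (x + y))) * (x + y) ^ p
      = (x + y) ^ p - p * x * (x + y) ^ (p - 1) := by
    rw [hpow]; field_simp; ring
  linarith

theorem rpow_add_rpow_mul_rpow_defect_le_of_le {x y lam : ℝ} (hx : 0 < x) (hxy : x ≤ y)
    (hlam0 : 0 ≤ lam) (hlam1 : lam < 1) :
    (x ^ lam + y ^ lam) * ((x + y) ^ (2 - lam) - x ^ (2 - lam) - y ^ (2 - lam))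
      ≤ 2 * ((2 : ℝ) ^ (1 - lam) * (2 - lam)) * (x * y) := by
  have hy : 0 < y := hx.trans_le hxy
  have hp : 0 ≤ 2 - lam := by linarith
  have hdefect : (x + y) ^ (2 - lam) - x ^ (2 - lam) - y ^ (2 - lam)
      ≤ (2 - lam) * x * (2 ^ (1 - lam) * y ^ (1 - lam)) := by
    have hd := add_rpow_sub_rpow_le hx hy (p := 2 - lam) (by linarith)
    have hmono : (x + y) ^ (2 - lam - 1) ≤ 2 ^ (1 - lam) * y ^ (1 - lam) := by
      rw [← Real.mul_rpow two_pos.le hy.le, show 2 - lam - 1 = 1 - lam by ring]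
      exact Real.rpow_le_rpow (by positivity) (by linarith) (by linarith)
    have hm := mul_le_mul_of_nonneg_left hmono (mul_nonneg hp hx.le)
    have hx0 : 0 ≤ x ^ (2 - lam) := by positivity
    linarith
  have hsum : x ^ lam + y ^ lam ≤ 2 * y ^ lam := by
    linarith [Real.rpow_le_rpow hx.le hxy hlam0]
  have hyy : y ^ lam * y ^ (1 - lam) = y := by
    rw [← Real.rpow_add hy]; simp
  calc (x ^ lam + y ^ lam) * ((x + y) ^ (2 - lam) - x ^ (2 - lam) - y ^ (2 - lam))
      ≤ (x ^ lam + y ^ lam) * ((2 - lam) * x * (2 ^ (1 - lam) * y ^ (1 - lam))) :=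
        mul_le_mul_of_nonneg_left hdefect (by positivity)
    _ ≤ (2 * y ^ lam) * ((2 - lam) * x * (2 ^ (1 - lam) * y ^ (1 - lam))) :=
        mul_le_mul_of_nonneg_right hsum (by positivity)
    _ = 2 * ((2 : ℝ) ^ (1 - lam) * (2 - lam)) * (x * (y ^ lam * y ^ (1 - lam))) := by ring
    _ = _ := by rw [hyy]

theorem rpow_add_rpow_mul_rpow_defect_le {x y lam : ℝ} (hx : 0 < x) (hy : 0 < y)
    (hlam0 : 0 ≤ lam) (hlam1 : lam < 1) :
    (x ^ lam + y ^ lam) * ((x + y) ^ (2 - lam) - x ^ (2 - lam) - y ^ (2 - lam))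
      ≤ 2 * ((2 : ℝ) ^ (1 - lam) * (2 - lam)) * (x * y) := by
  rcases le_total x y with h | h
  · exact rpow_add_rpow_mul_rpow_defect_le_of_le hx h hlam0 hlam1
  · convert rpow_add_rpow_mul_rpow_defect_le_of_le hy h hlam0 hlam1 using 1
    · rw [add_comm y x]; ring
    · ring

/-- In `[0,∞]`, the double sum of a product of nonnegative terms is the square of the sum. -/
theorem tsum_ofReal_mul_prod {f : ℕ → ℝ} {s : ℝ} (hf : ∀ i, 0 ≤ f i) (hs : HasSum f s) :
    ∑' p : ℕ × ℕ, ENNReal.ofReal (f p.1 * f p.2) = ENNReal.ofReal (s ^ 2) := by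
  have hsum : ∑' i, ENNReal.ofReal (f i) = ENNReal.ofReal s := by
    rw [← ENNReal.ofReal_tsum_of_nonneg hf hs.summable, hs.tsum_eq]
  simp_rw [ENNReal.tsum_prod', ENNReal.ofReal_mul (hf _), ENNReal.tsum_mul_left, hsum,
    ENNReal.tsum_mul_right, hsum]
  rw [sq, ENNReal.ofReal_mul (hs.nonneg hf)]

/-- Under the growth hypothesis `a_{i,j} ≤ K(i^λ + j^λ)` with `0 ≤ λ < 1`, for any
nonnegative sequence of mass `ρ`,
`(1/2) ∑_{i,j≥1} a_{i,j} c_i c_j ((i+j)^{2−λ} − i^{2−λ} − j^{2−λ}) ≤ K C' ρ²`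
with `C' = (1 + 2^λ) 2^{1−λ} (2−λ)`, in `[0,∞]`. -/
theorem moment_derivative_bound (a : ℕ → ℕ → ℝ) (K lam : ℝ)
    (hK : 0 < K) (hlam0 : 0 ≤ lam) (hlam1 : lam < 1)
    (ha_nonneg : ∀ i j : ℕ, 1 ≤ i → 1 ≤ j → 0 ≤ a i j)
    (ha_symm : ∀ i j : ℕ, a i j = a j i)
    (ha_le : ∀ i j : ℕ, 1 ≤ i → 1 ≤ j → a i j ≤ K * ((i : ℝ) ^ lam + (j : ℝ) ^ lam))
    (c : ℕ → ℝ) (hc : ∀ i, 0 ≤ c i) (ρ : ℝ)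
    (hmass : HasSum (fun i : ℕ => ((i : ℝ) + 1) * c (i + 1)) ρ) :
    2⁻¹ * ∑' p : ℕ × ℕ, ENNReal.ofReal
        (a (p.1 + 1) (p.2 + 1) * c (p.1 + 1) * c (p.2 + 1) *
          (((p.1 : ℝ) + (p.2 : ℝ) + 2) ^ (2 - lam)
            - ((p.1 : ℝ) + 1) ^ (2 - lam) - ((p.2 : ℝ) + 1) ^ (2 - lam)))
      ≤ ENNReal.ofReal (K * ((1 + (2 : ℝ) ^ lam) * (2 : ℝ) ^ (1 - lam) * (2 - lam)) * ρ ^ 2) := by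
  set C := K * ((1 + (2 : ℝ) ^ lam) * (2 : ℝ) ^ (1 - lam) * (2 - lam)) with hC
  have hp : 0 ≤ 2 - lam := by linarith
  have hC0 : 0 ≤ C := by positivity
  have hdouble : 2 * ((2 : ℝ) ^ (1 - lam) * (2 - lam))
      ≤ (1 + (2 : ℝ) ^ lam) * (2 : ℝ) ^ (1 - lam) * (2 - lam) := by
    have h2 : 1 ≤ (2 : ℝ) ^ lam := Real.one_le_rpow one_le_two hlam0
    rw [mul_assoc (1 + (2 : ℝ) ^ lam)]
    exact mul_le_mul_of_nonneg_right (by linarith) (by positivity)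
  have hterm : ∀ p : ℕ × ℕ,
      a (p.1 + 1) (p.2 + 1) * c (p.1 + 1) * c (p.2 + 1) *
          (((p.1 : ℝ) + (p.2 : ℝ) + 2) ^ (2 - lam)
            - ((p.1 : ℝ) + 1) ^ (2 - lam) - ((p.2 : ℝ) + 1) ^ (2 - lam))
      ≤ C * ((((p.1 : ℝ) + 1) * c (p.1 + 1)) * (((p.2 : ℝ) + 1) * c (p.2 + 1))) := by
    rintro ⟨i, j⟩
    dsimp only
    have hx : (0 : ℝ) < (i : ℝ) + 1 := by positivity
    have hy : (0 : ℝ) < (j : ℝ) + 1 := by positivity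
    have ha := ha_le (i + 1) (j + 1) (by omega) (by omega)
    push_cast at ha
    have hb := rpow_add_rpow_mul_rpow_defect_le hx hy hlam0 hlam1
    rw [show (i : ℝ) + j + 2 = ((i : ℝ) + 1) + ((j : ℝ) + 1) by ring]
    set x := (i : ℝ) + 1
    set y := (j : ℝ) + 1
    have hdefect : 0 ≤ (x + y) ^ (2 - lam) - x ^ (2 - lam) - y ^ (2 - lam) := by
      linarith [Real.add_rpow_le_rpow_add hx.le hy.le (p := 2 - lam) (by linarith)]
    have hcc : 0 ≤ c (i + 1) * c (j + 1) := mul_nonneg (hc _) (hc _)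
    calc a (i + 1) (j + 1) * c (i + 1) * c (j + 1)
          * ((x + y) ^ (2 - lam) - x ^ (2 - lam) - y ^ (2 - lam))
        = c (i + 1) * c (j + 1) * (a (i + 1) (j + 1)
          * ((x + y) ^ (2 - lam) - x ^ (2 - lam) - y ^ (2 - lam))) := by ring
      _ ≤ c (i + 1) * c (j + 1) * (K * (x ^ lam + y ^ lam)
          * ((x + y) ^ (2 - lam) - x ^ (2 - lam) - y ^ (2 - lam))) := by gcongr
      _ = c (i + 1) * c (j + 1) * (K * ((x ^ lam + y ^ lam)
          * ((x + y) ^ (2 - lam) - x ^ (2 - lam) - y ^ (2 - lam)))) := by ring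
      _ ≤ c (i + 1) * c (j + 1) * (K * (((1 + (2 : ℝ) ^ lam) * (2 : ℝ) ^ (1 - lam) * (2 - lam))
          * (x * y))) := by
        refine mul_le_mul_of_nonneg_left (mul_le_mul_of_nonneg_left ?_ hK.le) hcc
        exact hb.trans (mul_le_mul_of_nonneg_right hdouble (by positivity))
      _ = C * (x * c (i + 1) * (y * c (j + 1))) := by rw [hC]; ring
  calc _ ≤ 1 * ∑' p : ℕ × ℕ, ENNReal.ofReal
        (C * ((((p.1 : ℝ) + 1) * c (p.1 + 1)) * (((p.2 : ℝ) + 1) * c (p.2 + 1)))) := by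
        exact mul_le_mul' (ENNReal.inv_le_one.2 one_le_two)
          (ENNReal.tsum_le_tsum fun p => ENNReal.ofReal_le_ofReal (hterm p))
    _ = ENNReal.ofReal (C * ρ ^ 2) := by
        simp_rw [one_mul, ENNReal.ofReal_mul hC0, ENNReal.tsum_mul_left]
        rw [tsum_ofReal_mul_prod (f := fun i : ℕ => ((i : ℝ) + 1) * c (i + 1))
          (fun i => mul_nonneg (by positivity) (hc _)) hmass]
end
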